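/- If α is a real constant with 0 < α < 1, then lim_{n→∞} |Λ_n(⌊αn⌋) \ Π_n(⌊αn⌋)| / |Λ_n(⌊αn⌋)| = 1 (the limit taken along n for which Λ_n(⌊αn⌋) is nonempty and 3 ≤ ⌊αn⌋ ≤ n-1). -/

import Mathlib

open Finset

namespace Secretary

/-- Relative rank of `x` with regard to `P`: the number of `z ∈ P` with `z ≤ x`
(as an integer, so that differences can be computed in `ℤ`). -/
def rr {n : ℕ} (P : Finset (Fin n)) (x : Fin n) : ℤ :=
  ((P.filter fun z => z ≤ x).card : ℤ)

/-- `Δ(k) = {-1, 1, k-1, 1-k} ⊆ ℤ`. -/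
def Δ (k : ℕ) : Finset ℤ := {-1, 1, (k : ℤ) - 1, 1 - (k : ℤ)}

/-- `{x, y} ∈ Adj(P)`: both belong to `P` and the difference of their relative
ranks with regard to `P` (in one of the two orders) lies in `Δ(|P|)`. -/
def Adj {n : ℕ} (P : Finset (Fin n)) (x y : Fin n) : Prop :=
  x ∈ P ∧ y ∈ P ∧ (rr P x - rr P y ∈ Δ P.card ∨ rr P y - rr P x ∈ Δ P.card)

instance {n : ℕ} (P : Finset (Fin n)) (x y : Fin n) : Decidable (Adj P x y) := by
  unfold Adj; infer_instance

/-- `Ω n`: the sequences of `n` distinct applicants (as injective, hence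
bijective, functions `Fin n → Fin n`); `|Ω n| = n!`. -/
def Ω (n : ℕ) : Finset (Fin n → Fin n) :=
  Finset.univ.filter Function.Injective

/-- The `i`-th applicant of the sequence `x`, with the 1-based indexing
`x_1, …, x_n` of the paper. -/
def get {n : ℕ} [NeZero n] (x : Fin n → Fin n) (i : ℕ) : Fin n :=
  x ⟨(i - 1) % n, Nat.mod_lt _ (Nat.pos_of_ne_zero (NeZero.ne n))⟩

/-- The set `{x_1, …, x_i}` of the first `i` applicants of the sequence `x`. -/
def pre {n : ℕ} (x : Fin n → Fin n) (i : ℕ) : Finset (Fin n) :=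
  (Finset.univ.filter fun j : Fin n => (j : ℕ) < i).image x

/-- `Λ_n(r,k)`: sequences `x ∈ Ω_n` with `{x_k, x_{k+1}} ∈ Adj(C_n)` and
`{x_{i-1}, x_i} ∉ Adj({x_1,…,x_i})` for all `i ∈ {r,…,k}`. -/
def Lam : (n : ℕ) → ℕ → ℕ → Finset (Fin n → Fin n)
  | 0, _, _ => ∅
  | (m + 1), r, k =>
      (Ω (m + 1)).filter fun x =>
        Adj Finset.univ (get x k) (get x (k + 1)) ∧
          ∀ i, i ≤ k → r ≤ i → ¬ Adj (pre x i) (get x (i - 1)) (get x i)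

/-- `Λ_n(r) = ⋃_{k=r}^{n-1} Λ_n(r,k)`. -/
def LamU (n : ℕ) (r : ℕ) : Finset (Fin n → Fin n) :=
  (Finset.Icc r (n - 1)).biUnion fun k => Lam n r k

/-- `Π_n(r)`: those `x ∈ Λ_n(r)` such that for the (unique) `k` with
`x ∈ Λ_n(r,k)` one has `rr_n(x_k) - rr_n(x_{k+1}) ∈ {1-n, n-1}`. -/
def Pi' : (n : ℕ) → ℕ → Finset (Fin n → Fin n)
  | 0, _ => ∅
  | (m + 1), r =>
      (LamU (m + 1) r).filter fun x =>
        ∃ k ∈ Finset.Icc r m, x ∈ Lam (m + 1) r k ∧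
          rr Finset.univ (get x k) - rr Finset.univ (get x (k + 1)) ∈
            ({1 - ((m : ℤ) + 1), ((m : ℤ) + 1) - 1} : Finset ℤ)

/-- `Λ_n(r,k,z,z̄)`: sequences of `Λ_n(r,k)` with `x_k = z` and `x_{k+1} = z̄`. -/
def Lam4 : (n : ℕ) → ℕ → ℕ → Fin n → Fin n → Finset (Fin n → Fin n)
  | 0, _, _, z, _ => z.elim0
  | (m + 1), r, k, z, w =>
      (Lam (m + 1) r k).filter fun x => get x k = z ∧ get x (k + 1) = w

/-- `y` is reached no later than any other element of `P` when going around the cycle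
`Fin n` upwards from `x`. -/
def IsNext {n : ℕ} (P : Finset (Fin n)) (x y : Fin n) : Prop :=
  ∀ z ∈ P, z ≠ x → y - x ≤ z - x

theorem adj_comm {n : ℕ} {P : Finset (Fin n)} {x y : Fin n} : Adj P x y ↔ Adj P y x := by
  unfold Adj; tauto

theorem val_sub_eq {n : ℕ} (z x : Fin n) :
    ((z - x : Fin n) : ℕ) = if x ≤ z then (z : ℕ) - x else z + n - x := by
  split_ifs with h
  · exact Fin.sub_val_of_le h
  · rw [Fin.coe_sub_iff_lt.2 (not_le.1 h)]; omega

theorem isNext_iff_of_lt {n : ℕ} {P : Finset (Fin n)} {x y : Fin n} (h : x < y) :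
    IsNext P x y ↔ ∀ z ∈ P, ¬ (x < z ∧ z < y) := by
  unfold IsNext
  refine forall₂_congr fun z _ => ?_
  simp only [Fin.le_def, val_sub_eq, Fin.lt_def, ne_eq, Fin.ext_iff] at h ⊢
  have := y.2
  split_ifs <;> omega

theorem isNext_iff_of_gt {n : ℕ} {P : Finset (Fin n)} {x y : Fin n} (h : x < y) :
    IsNext P y x ↔ ∀ z ∈ P, ¬ (z < x ∨ y < z) := by
  unfold IsNext
  refine forall₂_congr fun z _ => ?_
  simp only [Fin.le_def, val_sub_eq, Fin.lt_def, ne_eq, Fin.ext_iff] at h ⊢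
  have := y.2
  have := z.2
  split_ifs <;> omega

theorem adj_iff_of_lt {n : ℕ} {P : Finset (Fin n)} {x y : Fin n} (h : x < y) :
    Adj P x y ↔ x ∈ P ∧ y ∈ P ∧ (IsNext P x y ∨ IsNext P y x) := by
  unfold Adj
  refine and_congr_right fun hx => and_congr_right fun hy => ?_
  rw [isNext_iff_of_lt h, isNext_iff_of_gt h, ← Finset.filter_eq_empty_iff,
    ← Finset.filter_eq_empty_iff, ← Finset.card_eq_zero, ← Finset.card_eq_zero]
  have hbetween : #{z ∈ P | z ≤ y} = #{z ∈ P | z ≤ x} + #{z ∈ P | x < z ∧ z < y} + 1 := by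
    rw [← Finset.card_union_of_disjoint, ← Finset.card_insert_of_notMem (a := y)]
    · congr 1
      ext z
      simp only [mem_filter, mem_insert, mem_union]
      grind
    · simp [h]
    · rw [Finset.disjoint_filter]
      intro z _ h1 h2
      exact absurd h2.1 (not_lt.2 h1)
  have htotal : #P = #{z ∈ P | x < z ∧ z < y} + #{z ∈ P | z < x ∨ y < z} + 2 := by
    rw [← Finset.card_union_of_disjoint, ← Finset.card_pair h.ne, ← Finset.card_union_of_disjoint]
    · congr 1
      ext z
      simp only [mem_filter, mem_insert, mem_union, mem_singleton]
      grind
    · rw [Finset.disjoint_left]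
      intro z
      simp only [mem_filter, mem_insert, mem_union, mem_singleton]
      grind
    · rw [Finset.disjoint_filter]
      intro z _ h1 h2
      grind
  simp only [rr, Δ, mem_insert, mem_singleton]
  omega

theorem adj_iff_of_ne {n : ℕ} {P : Finset (Fin n)} {x y : Fin n} (h : x ≠ y) :
    Adj P x y ↔ x ∈ P ∧ y ∈ P ∧ (IsNext P x y ∨ IsNext P y x) := by
  rcases lt_or_gt_of_ne h with h | h
  · exact adj_iff_of_lt h
  · rw [adj_comm, adj_iff_of_lt h]; tauto

theorem adj_self_iff {n : ℕ} {P : Finset (Fin n)} {x : Fin n} :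
    Adj P x x ↔ x ∈ P ∧ #P = 1 := by
  simp only [Adj, Δ, mem_insert, mem_singleton, sub_self, or_self, and_self_left]
  exact and_congr_right fun _ => by omega

theorem Adj.mono_of_ne {n : ℕ} {P Q : Finset (Fin n)} {x y : Fin n} (hPQ : P ⊆ Q)
    (hne : x ≠ y) (hx : x ∈ P) (hy : y ∈ P) (h : Adj Q x y) : Adj P x y := by
  rw [adj_iff_of_ne hne] at h ⊢
  exact ⟨hx, hy, h.2.2.imp (fun H z hz => H z (hPQ hz)) fun H z hz => H z (hPQ hz)⟩

theorem adj_image_add_right {m : ℕ} (P : Finset (Fin (m + 1))) (x y c : Fin (m + 1)) :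
    Adj (P.image (· + c)) (x + c) (y + c) ↔ Adj P x y := by
  have hinj : Function.Injective (· + c) := add_left_injective c
  have hmem (w : Fin (m + 1)) : w + c ∈ P.image (· + c) ↔ w ∈ P := hinj.mem_finset_image
  by_cases hxy : x = y
  · subst hxy
    rw [adj_self_iff, adj_self_iff, hmem, Finset.card_image_of_injective _ hinj]
  · have hnext (u v : Fin (m + 1)) : IsNext (P.image (· + c)) (u + c) (v + c) ↔ IsNext P u v := by
      simp only [IsNext, Finset.forall_mem_image, add_sub_add_right_eq_sub, ne_eq, add_left_inj]
    rw [adj_iff_of_ne hxy, adj_iff_of_ne (hinj.ne hxy), hmem, hmem, hnext, hnext]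

theorem lam_add_right {m r k : ℕ} {x : Fin (m + 1) → Fin (m + 1)} (hx : x ∈ Lam (m + 1) r k)
    (c : Fin (m + 1)) : (fun j => x j + c) ∈ Lam (m + 1) r k := by
  have hpre (i : ℕ) : pre (fun j => x j + c) i = (pre x i).image (· + c) := by
    simp only [pre, Finset.image_image]; rfl
  have hget (i : ℕ) : get (fun j => x j + c) i = get x i + c := rfl
  have huniv : (univ : Finset (Fin (m + 1))) = univ.image (· + c) :=
    (Finset.image_univ_of_surjective (add_right_surjective c)).symm
  simp only [Lam, Ω, mem_filter, mem_univ, true_and] at hx ⊢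
  refine ⟨(add_left_injective c).comp hx.1, ?_, fun i hk hr => ?_⟩
  · rw [hget, hget, huniv, adj_image_add_right]
    exact hx.2.1
  · rw [hget, hget, hpre, adj_image_add_right]
    exact hx.2.2 i hk hr

theorem get_mem_pre {m i j : ℕ} (x : Fin (m + 1) → Fin (m + 1)) (hi : 1 ≤ i) (hij : i ≤ j) :
    get x i ∈ pre x j :=
  Finset.mem_image_of_mem x (Finset.mem_filter.2
    ⟨mem_univ _, (Nat.mod_le _ _).trans_lt (by omega)⟩)

theorem get_ne_get_succ {m k : ℕ} {x : Fin (m + 1) → Fin (m + 1)} (hx : x.Injective)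
    (hk : 1 ≤ k) (hkm : k ≤ m) : get x k ≠ get x (k + 1) := by
  intro h
  have h' := congrArg Fin.val (hx h)
  simp only [Nat.add_sub_cancel] at h'
  rw [Nat.mod_eq_of_lt (by omega), Nat.mod_eq_of_lt (by omega)] at h'
  omega

theorem le_of_mem_lam {m r k l : ℕ} {x : Fin (m + 1) → Fin (m + 1)} (hr : 1 ≤ r) (hrk : r ≤ k)
    (hkm : k ≤ m) (hk : x ∈ Lam (m + 1) r k) (hl : x ∈ Lam (m + 1) r l) : l ≤ k := by
  by_contra! hkl
  simp only [Lam, Ω, mem_filter, mem_univ, true_and] at hk hl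
  refine hl.2.2 (k + 1) hkl (by omega) ?_
  exact hk.2.1.mono_of_ne (subset_univ _) (get_ne_get_succ hk.1 (by omega) hkm)
    (get_mem_pre x (by omega) (by omega)) (get_mem_pre x (by omega) le_rfl)

theorem rr_univ {n : ℕ} (x : Fin n) : rr univ x = (x : ℤ) + 1 := by
  have : (univ.filter fun z => z ≤ x) = Finset.Iic x := by ext; simp
  simp [rr, this]

theorem extremes_of_rr_sub {m : ℕ} {x y : Fin (m + 1)}
    (h : rr univ x - rr univ y ∈ ({1 - ((m : ℤ) + 1), ((m : ℤ) + 1) - 1} : Finset ℤ)) :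
    x = 0 ∧ y = Fin.last m ∨ x = Fin.last m ∧ y = 0 := by
  simp only [rr_univ, mem_insert, mem_singleton] at h
  simp only [Fin.ext_iff, Fin.val_zero, Fin.val_last]
  omega

/-- A translation preserving the pair formed by the two extreme applicants is trivial. -/
theorem eq_zero_of_add_extremes {m : ℕ} (hm : 2 ≤ m) {x y c : Fin (m + 1)}
    (h : x = 0 ∧ y = Fin.last m ∨ x = Fin.last m ∧ y = 0)
    (h' : x + c = 0 ∧ y + c = Fin.last m ∨ x + c = Fin.last m ∧ y + c = 0) : c = 0 := by
  have hlast (d : Fin (m + 1)) (hd : d = Fin.last m) (h0 : Fin.last m + d = 0) : False := by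
    subst hd
    have := congrArg Fin.val h0
    simp only [Fin.val_add, Fin.val_last, Fin.val_zero] at this
    rw [Nat.mod_eq_sub_mod (by omega), Nat.mod_eq_of_lt (by omega)] at this
    omega
  rcases h with ⟨rfl, rfl⟩ | ⟨rfl, rfl⟩ <;> rcases h' with ⟨h1, h2⟩ | ⟨h1, h2⟩ <;>
    simp only [zero_add] at h1 h2
  · exact h1
  · exact (hlast c h1 h2).elim
  · exact (hlast c h2 h1).elim
  · exact h2

theorem pi_subset_lamU (n r : ℕ) : Pi' n r ⊆ LamU n r := by
  cases n with
  | zero => exact Finset.empty_subset _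
  | succ m => exact Finset.filter_subset _ _

/-- The translates of the sequences in `Π_n(r)` are distinct members of `Λ_n(r)`. -/
theorem mul_card_pi_le {n r : ℕ} (hn : 3 ≤ n) (hr : 1 ≤ r) :
    n * #(Pi' n r) ≤ #(LamU n r) := by
  obtain ⟨m, rfl⟩ : ∃ m, n = m + 1 := ⟨n - 1, by omega⟩
  let f : Fin (m + 1) × (Fin (m + 1) → Fin (m + 1)) → (Fin (m + 1) → Fin (m + 1)) :=
    fun p j => p.2 j + p.1
  have hcard : #(univ ×ˢ Pi' (m + 1) r : Finset (Fin (m + 1) × _)) = (m + 1) * #(Pi' (m + 1) r) := by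
    simp
  rw [← hcard]
  refine Finset.card_le_card_of_injOn f ?_ ?_
  · rintro ⟨c, x⟩ hx
    simp only [coe_product, Set.mem_prod, mem_coe, mem_univ, true_and] at hx
    obtain ⟨k, hk, hxk⟩ := Finset.mem_biUnion.1 (pi_subset_lamU _ _ hx)
    exact Finset.mem_biUnion.2 ⟨k, hk, lam_add_right hxk c⟩
  · rintro ⟨c, x⟩ hx ⟨d, y⟩ hy hxy
    simp only [coe_product, Set.mem_prod, mem_coe, mem_univ, true_and] at hx hy
    simp only [Pi', mem_filter, mem_Icc] at hx hy
    obtain ⟨-, k, ⟨hrk, hkm⟩, hxk, hx⟩ := hx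
    obtain ⟨-, l, ⟨hrl, hlm⟩, hyl, hy⟩ := hy
    have hyx : y = fun j => x j + (c - d) := by
      funext j
      have : x j + c = y j + d := congrFun hxy j
      rw [← add_sub_assoc, this, add_sub_cancel_right]
    have hyk : y ∈ Lam (m + 1) r k := hyx ▸ lam_add_right hxk (c - d)
    obtain rfl : k = l :=
      (le_of_mem_lam hr hrl hlm hyl hyk).antisymm (le_of_mem_lam hr hrk hkm hyk hyl)
    have hy' := extremes_of_rr_sub hy
    rw [hyx] at hy'
    have hcd : c - d = 0 := eq_zero_of_add_extremes (by omega) (extremes_of_rr_sub hx) hy'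
    simp [hyx, sub_eq_zero.1 hcd]

theorem lamU_nonempty {n r : ℕ} (hr : 4 ≤ r) (hrn : r < n) : (LamU n r).Nonempty := by
  obtain ⟨m, rfl⟩ : ∃ m, n = m + 1 := ⟨n - 1, by omega⟩
  let p : Fin 5 → Fin (m + 1) := ![⟨0, by omega⟩, ⟨1, by omega⟩, ⟨r - 1 - 1, by omega⟩,
    ⟨r - 1, by omega⟩, ⟨r, hrn⟩]
  let q : Fin 5 → Fin (m + 1) := ![⟨2, by omega⟩, ⟨4, by omega⟩, ⟨3, by omega⟩,
    ⟨0, by omega⟩, ⟨1, by omega⟩]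
  have hp : p.Injective := by
    intro i j h
    fin_cases i <;> fin_cases j <;> simp [p] at h ⊢ <;> omega
  have hq : q.Injective := by
    intro i j h
    fin_cases i <;> fin_cases j <;> simp [q] at h ⊢
  obtain ⟨g, hg⟩ := (Equiv.Perm.isMultiplyPretransitive (Fin (m + 1)) 5).exists_smul_eq
    ⟨p, hp⟩ ⟨q, hq⟩
  have hgp (i : Fin 5) : g (p i) = q i := congrArg (fun e => e i) hg
  have hget (i : ℕ) (hi : i - 1 < m + 1) : get g i = g ⟨i - 1, hi⟩ := by
    simp only [get, Nat.mod_eq_of_lt hi]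
  have h1 : get g (r - 1) = q 2 := by rw [hget _ (by omega)]; exact hgp 2
  have h2 : get g r = q 3 := by rw [hget _ (by omega)]; exact hgp 3
  have h3 : get g (r + 1) = q 4 := by rw [hget _ (by omega)]; exact hgp 4
  have h4 : q 0 ∈ pre g r := by
    rw [← hgp 0]
    exact mem_image_of_mem _ (mem_filter.2 ⟨mem_univ _, show 0 < r by omega⟩)
  have h5 : q 1 ∈ pre g r := by
    rw [← hgp 1]
    exact mem_image_of_mem _ (mem_filter.2 ⟨mem_univ _, show 1 < r by omega⟩)
  refine ⟨g, Finset.mem_biUnion.2 ⟨r, mem_Icc.2 ⟨le_rfl, by omega⟩, ?_⟩⟩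
  simp only [Lam, Ω, mem_filter, mem_univ, true_and]
  refine ⟨g.injective, ?_, fun i hi hri => ?_⟩
  · have hlt : q 3 < q 4 := show 0 < 1 by omega
    rw [h2, h3, adj_iff_of_lt hlt, isNext_iff_of_lt hlt]
    refine ⟨mem_univ _, mem_univ _, Or.inl fun z _ hz => ?_⟩
    have hz1 : 0 < (z : ℕ) := hz.1
    have hz2 : (z : ℕ) < 1 := hz.2
    omega
  · obtain rfl : i = r := le_antisymm hi hri
    have hlt : q 3 < q 2 := show 0 < 3 by omega
    rw [h1, h2, adj_comm, adj_iff_of_lt hlt, isNext_iff_of_lt hlt, isNext_iff_of_gt hlt]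
    rintro ⟨-, -, h | h⟩
    · exact h _ h4 ⟨show 0 < 2 by omega, show 2 < 3 by omega⟩
    · exact h _ h5 (Or.inr (show 3 < 4 by omega))

/-- for real `0 < α < 1`,
`lim_{n→∞} |Λ_n(⌊αn⌋) \ Π_n(⌊αn⌋)| / |Λ_n(⌊αn⌋)| = 1`. -/
theorem statement12 (α : ℝ) (h0 : 0 < α) (h1 : α < 1) :
    Filter.Tendsto (fun n : ℕ =>
        ((LamU n ⌊α * n⌋₊ \ Pi' n ⌊α * n⌋₊).card : ℝ) /
          ((LamU n ⌊α * n⌋₊).card : ℝ))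
      Filter.atTop (nhds 1) := by
  have hlow : Filter.Tendsto (fun n : ℕ => 1 - 1 / (n : ℝ)) Filter.atTop (nhds 1) := by
    simpa using tendsto_one_div_atTop_nhds_zero_nat.const_sub (1 : ℝ)
  have hev : ∀ᶠ n : ℕ in Filter.atTop, (4 : ℝ) ≤ α * n :=
    (tendsto_natCast_atTop_atTop.const_mul_atTop h0).eventually_ge_atTop 4
  refine tendsto_of_tendsto_of_tendsto_of_le_of_le' hlow tendsto_const_nhds ?_ ?_
  · filter_upwards [hev] with n hn
    have hr : 4 ≤ ⌊α * n⌋₊ := Nat.le_floor (by exact_mod_cast hn)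
    have hn0 : (0 : ℝ) < n := by
      by_contra! h
      nlinarith
    have hrn : ⌊α * n⌋₊ < n := (Nat.floor_lt (by linarith)).2 (by nlinarith)
    have hpos : (0 : ℝ) < #(LamU n ⌊α * n⌋₊) := by
      exact_mod_cast (lamU_nonempty hr hrn).card_pos
    have hmul : (n : ℝ) * #(Pi' n ⌊α * n⌋₊) ≤ #(LamU n ⌊α * n⌋₊) := by
      exact_mod_cast mul_card_pi_le (n := n) (r := ⌊α * n⌋₊) (by omega) (by omega)
    rw [Finset.cast_card_sdiff (pi_subset_lamU _ _), sub_div, div_self hpos.ne']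
    gcongr 1 - ?_
    rw [div_le_div_iff₀ hpos hn0]
    linarith
  · refine Filter.Eventually.of_forall fun n => ?_
    refine div_le_one_of_le₀ ?_ (Nat.cast_nonneg _)
    exact_mod_cast Finset.card_le_card Finset.sdiff_subset
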